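/- Deep linear network fixed-point equation. Let n, d, L be positive integers with L ≥ 1 and β > 0, λ > 0 reals. Parameters: W⁰ an n×d real matrix, W¹, …, W^{L-1} n×n real matrices, W^L a 1×n real matrix; network function f(x) = β * (W^L W^{L-1} ⋯ W⁰ x) for x ∈ ℝ^d. Given finitely many samples x_s ∈ ℝ^d and differentiable sample losses ℓ_s : ℝ → ℝ, suppose (W⁰, …, W^L) is a critical point of L_tot = Σ_s ℓ_s(f(x_s)) + (λ/2) Σ_{l=0}^{L} ‖W^l‖_F², and suppose the critical point is nontrivial in the sense that f̃ := -(1/λ) Σ_s ℓ_s'(f(x_s)) * f(x_s) ≠ 0. Then λ^{L+1} / β² = ( - Σ_s ℓ_s'(f(x_s)) * f(x_s) )^{L-1} * Σ_{s,s'} ℓ_s'(f(x_s)) * ℓ_{s'}'(f(x_{s'})) * ⟨x_s, x_{s'}⟩. -/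

import Mathlib

open Matrix

attribute [local instance] Matrix.normedAddCommGroup Matrix.normedSpace

/-- `prodSegDL M l c = M (l+c-1) * ⋯ * M (l+1) * M l`, the ordered product of the
matrices `M l, …, M (l+c-1)` (and `1` when `c = 0`). -/
def prodSegDL {n : ℕ} (M : ℕ → Matrix (Fin n) (Fin n) ℝ) (l : ℕ) :
    ℕ → Matrix (Fin n) (Fin n) ℝ
  | 0 => 1
  | c + 1 => M (l + c) * prodSegDL M l c

/-- Total `L2`-regularized loss of a deep linear network `f(x) = β W^L ⋯ W⁰ x`, with
`W⁰ = W0`, `W^l = M l` for `1 ≤ l ≤ L-1`, and `W^L` the row vector `wL`. -/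
noncomputable def deepLinearLoss (n d L S : ℕ) (β lam : ℝ) (x : Fin S → Fin d → ℝ)
    (ℓ : Fin S → ℝ → ℝ) (W0 : Matrix (Fin n) (Fin d) ℝ)
    (M : ℕ → Matrix (Fin n) (Fin n) ℝ) (wL : Fin n → ℝ) : ℝ :=
  (∑ s, ℓ s (β * (wL ⬝ᵥ (prodSegDL M 1 (L - 1) *ᵥ (W0 *ᵥ x s))))) +
    lam / 2 * ((∑ i, ∑ j, W0 i j ^ 2) +
      (∑ l ∈ Finset.Icc 1 (L - 1), ∑ i, ∑ j, M l i j ^ 2) + ∑ i, wL i ^ 2)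

/-- Stationarity of a sum of scalar losses of linear functionals plus a sum of squares of linear
functionals, tested in the direction `v`. -/
theorem sum_deriv_mul_add_eq_zero_of_fderiv_eq_zero {E S ι : Type*} [NormedAddCommGroup E]
    [NormedSpace ℝ E] [FiniteDimensional ℝ E] [Fintype S] [Fintype ι] {ℓ : S → ℝ → ℝ}
    (hℓ : ∀ s, Differentiable ℝ (ℓ s)) (Λ : S → E →ₗ[ℝ] ℝ) (φ : ι → E →ₗ[ℝ] ℝ) (lam C : ℝ) (w : E)
    (hcrit : fderiv ℝ (fun V => (∑ s, ℓ s (Λ s V)) + lam / 2 * (C + ∑ i, φ i V ^ 2)) w = 0)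
    (v : E) :
    (∑ s, deriv (ℓ s) (Λ s w) * Λ s v) + lam * ∑ i, φ i w * φ i v = 0 := by
  have hΛ (s : S) : HasFDerivAt (fun V => ℓ s (Λ s V))
      (deriv (ℓ s) (Λ s w) • (Λ s).toContinuousLinearMap) w :=
    (hℓ s (Λ s w)).hasDerivAt.comp_hasFDerivAt w (Λ s).toContinuousLinearMap.hasFDerivAt
  have hφ (i : ι) : HasFDerivAt (fun V => φ i V ^ 2)
      ((2 * φ i w) • (φ i).toContinuousLinearMap) w := by
    have h := (hasDerivAt_pow 2 (φ i w)).comp_hasFDerivAt w (φ i).toContinuousLinearMap.hasFDerivAt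
    norm_num at h
    exact h
  have key := (HasFDerivAt.fun_sum fun s (_ : s ∈ Finset.univ) => hΛ s).add
    (((HasFDerivAt.fun_sum fun i (_ : i ∈ Finset.univ) => hφ i).const_add C).const_mul (lam / 2))
  have h := congrArg (fun T => T v) (key.fderiv.symm.trans hcrit)
  simp only [_root_.add_apply, _root_.smul_apply,
    _root_.sum_apply, LinearMap.coe_toContinuousLinearMap', smul_eq_mul,
    _root_.zero_apply] at h
  rw [← h, Finset.mul_sum, Finset.mul_sum]
  congr 1
  exact Finset.sum_congr rfl fun i _ => by ring

/-- Stationarity in a matrix `W` which enters the network through `a ⬝ᵥ W *ᵥ b s`, tested in the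
direction `(W q) qᵀ` with `q` the sum of the inputs `b s` weighted by the loss derivatives. -/
theorem dotProduct_mulVec_self_of_fderiv_eq_zero {m k S : ℕ} {ℓ : Fin S → ℝ → ℝ}
    (hℓ : ∀ s, Differentiable ℝ (ℓ s)) (β lam C : ℝ) (W : Matrix (Fin m) (Fin k) ℝ)
    (a : Fin m → ℝ) (b : Fin S → Fin k → ℝ) (g : Fin S → ℝ)
    (hg : ∀ s, g s = deriv (ℓ s) (β * (a ⬝ᵥ (W *ᵥ b s))))
    (hcrit : fderiv ℝ (fun V : Matrix (Fin m) (Fin k) ℝ =>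
      (∑ s, ℓ s (β * (a ⬝ᵥ (V *ᵥ b s)))) + lam / 2 * (C + ∑ i, ∑ j, V i j ^ 2)) W = 0)
    (q : Fin k → ℝ) (hq : q = ∑ s, g s • b s) :
    β * (a ⬝ᵥ (W *ᵥ q)) * (q ⬝ᵥ q) + lam * ((W *ᵥ q) ⬝ᵥ (W *ᵥ q)) = 0 := by
  let Λ (s : Fin S) : Matrix (Fin m) (Fin k) ℝ →ₗ[ℝ] ℝ :=
    { toFun := fun V => β * (a ⬝ᵥ (V *ᵥ b s))
      map_add' := fun V V' => by rw [add_mulVec, dotProduct_add, mul_add]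
      map_smul' := fun r V => by
        rw [smul_mulVec, dotProduct_smul, smul_eq_mul, smul_eq_mul, RingHom.id_apply]; ring }
  let φ (p : Fin m × Fin k) : Matrix (Fin m) (Fin k) ℝ →ₗ[ℝ] ℝ := entryLinearMap ℝ ℝ p.1 p.2
  have h := sum_deriv_mul_add_eq_zero_of_fderiv_eq_zero hℓ Λ φ lam C W
    (by simp only [Fintype.sum_prod_type]; exact hcrit) (vecMulVec (W *ᵥ q) q)
  have hΛ (s : Fin S) : deriv (ℓ s) (Λ s W) * Λ s (vecMulVec (W *ᵥ q) q) =
      β * (a ⬝ᵥ (W *ᵥ q)) * (q ⬝ᵥ (g s • b s)) := by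
    change deriv (ℓ s) (β * (a ⬝ᵥ (W *ᵥ b s))) * (β * (a ⬝ᵥ (vecMulVec (W *ᵥ q) q *ᵥ b s))) = _
    rw [← hg, vecMulVec_mulVec, op_smul_eq_smul, dotProduct_smul, dotProduct_smul, smul_eq_mul,
      smul_eq_mul]
    ring
  have hφ : ∑ p, φ p W * φ p (vecMulVec (W *ᵥ q) q) = (W *ᵥ q) ⬝ᵥ (W *ᵥ q) := by
    rw [Fintype.sum_prod_type]
    refine Finset.sum_congr rfl fun i _ => ?_
    change ∑ j, W i j * ((W *ᵥ q) i * q j) = (W *ᵥ q) i * ∑ j, W i j * q j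
    rw [Finset.mul_sum]
    exact Finset.sum_congr rfl fun j _ => by ring
  rwa [Finset.sum_congr rfl fun s _ => hΛ s, ← Finset.mul_sum, ← dotProduct_sum, ← hq, hφ] at h

theorem prodSegDL_add {n : ℕ} (M : ℕ → Matrix (Fin n) (Fin n) ℝ) (l a b : ℕ) :
    prodSegDL M l (a + b) = prodSegDL M (l + a) b * prodSegDL M l a := by
  induction b with
  | zero => simp [prodSegDL]
  | succ b ih => rw [← add_assoc, prodSegDL, ih, prodSegDL, Matrix.mul_assoc, add_assoc]

theorem prodSegDL_update_of_notMem {n : ℕ} (M : ℕ → Matrix (Fin n) (Fin n) ℝ)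
    (V : Matrix (Fin n) (Fin n) ℝ) {k l c : ℕ} (h : k < l ∨ l + c ≤ k) :
    prodSegDL (Function.update M k V) l c = prodSegDL M l c := by
  induction c with
  | zero => rfl
  | succ c ih => rw [prodSegDL, prodSegDL, ih (by lia), Function.update_of_ne (by lia)]

theorem prodSegDL_update {n : ℕ} (M : ℕ → Matrix (Fin n) (Fin n) ℝ)
    (V : Matrix (Fin n) (Fin n) ℝ) (l a b : ℕ) :
    prodSegDL (Function.update M (l + a) V) l (a + 1 + b) =
      prodSegDL M (l + (a + 1)) b * (V * prodSegDL M l a) := by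
  rw [prodSegDL_add, prodSegDL, Function.update_self, prodSegDL_update_of_notMem _ _ (by lia),
    prodSegDL_update_of_notMem _ _ (by lia)]

/-- Deep linear network fixed-point equation: at a nontrivial critical point of the
`L2`-regularized loss (i.e. one with `f̃ = -(1/λ) ∑ₛ ℓₛ'(f(xₛ)) f(xₛ) ≠ 0`),
`λ^{L+1}/β² = (-∑ₛ ℓₛ'(f(xₛ)) f(xₛ))^{L-1} ∑_{s,s'} ℓₛ'(f(xₛ)) ℓ_{s'}'(f(x_{s'})) ⟨xₛ, x_{s'}⟩`. -/
theorem deep_linear_fixed_point_equation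
    (n d L S : ℕ) (hn : 0 < n) (hd : 0 < d) (hL : 1 ≤ L)
    (β lam : ℝ) (hβ : 0 < β) (hlam : 0 < lam)
    (x : Fin S → Fin d → ℝ) (ℓ : Fin S → ℝ → ℝ) (hℓ : ∀ s, Differentiable ℝ (ℓ s))
    (W0 : Matrix (Fin n) (Fin d) ℝ) (M : ℕ → Matrix (Fin n) (Fin n) ℝ) (wL : Fin n → ℝ)
    (hcrit0 : fderiv ℝ (fun V => deepLinearLoss n d L S β lam x ℓ V M wL) W0 = 0)
    (hcritmid : ∀ l, 1 ≤ l → l ≤ L - 1 →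
      fderiv ℝ (fun V => deepLinearLoss n d L S β lam x ℓ W0 (Function.update M l V) wL)
        (M l) = 0)
    (hcritL : fderiv ℝ (fun v => deepLinearLoss n d L S β lam x ℓ W0 M v) wL = 0)
    (fval : Fin S → ℝ)
    (hfval : fval = fun s => β * (wL ⬝ᵥ (prodSegDL M 1 (L - 1) *ᵥ (W0 *ᵥ x s))))
    (ftil : ℝ) (hftil : ftil = -(1 / lam) * ∑ s, deriv (ℓ s) (fval s) * fval s)
    (hnontriv : ftil ≠ 0) :
    lam ^ (L + 1) / β ^ 2 =
      (-(∑ s, deriv (ℓ s) (fval s) * fval s)) ^ (L - 1) *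
        ∑ s, ∑ s', deriv (ℓ s) (fval s) * deriv (ℓ s') (fval s') * (x s ⬝ᵥ x s') := by
  subst hfval
  set f : Fin S → ℝ := fun s => β * (wL ⬝ᵥ (prodSegDL M 1 (L - 1) *ᵥ (W0 *ᵥ x s))) with hf
  set g : Fin S → ℝ := fun s => deriv (ℓ s) (f s) with hg
  set q : Fin d → ℝ := ∑ s, g s • x s with hq
  let h (k : ℕ) : Fin n → ℝ := prodSegDL M 1 k *ᵥ (W0 *ᵥ q)
  have hsum (k : ℕ) : h k = ∑ s, g s • (prodSegDL M 1 k *ᵥ (W0 *ᵥ x s)) := by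
    simp only [h, hq, mulVec_sum, mulVec_smul]
  set F : ℝ := wL ⬝ᵥ h (L - 1) with hF
  have hgf : ∑ s, g s * f s = β * F := by
    rw [hF, hsum, dotProduct_sum, Finset.mul_sum]
    refine Finset.sum_congr rfl fun s _ => ?_
    rw [dotProduct_smul, smul_eq_mul, hf]
    ring
  have hqq : ∑ s, ∑ s', g s * g s' * (x s ⬝ᵥ x s') = q ⬝ᵥ q := by
    rw [hq, sum_dotProduct]
    refine Finset.sum_congr rfl fun s _ => ?_
    rw [dotProduct_sum]
    refine Finset.sum_congr rfl fun s' _ => ?_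
    rw [smul_dotProduct, dotProduct_smul, smul_eq_mul, smul_eq_mul, mul_assoc]
  have hinput : β * F * (q ⬝ᵥ q) + lam * (h 0 ⬝ᵥ h 0) = 0 := by
    have hout (y : Fin n → ℝ) :
        (wL ᵥ* prodSegDL M 1 (L - 1)) ⬝ᵥ y = wL ⬝ᵥ (prodSegDL M 1 (L - 1) *ᵥ y) :=
      (dotProduct_mulVec _ _ _).symm
    have key := dotProduct_mulVec_self_of_fderiv_eq_zero hℓ β lam
      ((∑ l ∈ Finset.Icc 1 (L - 1), ∑ i, ∑ j, M l i j ^ 2) + ∑ i, wL i ^ 2) W0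
      (wL ᵥ* prodSegDL M 1 (L - 1)) x g (fun s => by rw [hout])
      (by
        rw [← hcrit0]
        congr 1
        funext V
        simp only [deepLinearLoss, hout]
        ring) q hq
    rw [hout] at key
    simpa only [h, prodSegDL, one_mulVec] using key
  have hhidden (k : ℕ) (hk : k + 1 ≤ L - 1) :
      β * F * (h k ⬝ᵥ h k) + lam * (h (k + 1) ⬝ᵥ h (k + 1)) = 0 := by
    obtain ⟨b, hb⟩ := Nat.exists_eq_add_of_le hk
    have hstep : M (1 + k) *ᵥ h k = h (k + 1) := by
      simp only [h, prodSegDL, mulVec_mulVec, Matrix.mul_assoc]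
    have hout (V : Matrix (Fin n) (Fin n) ℝ) (y : Fin n → ℝ) :
        (wL ᵥ* prodSegDL M (1 + (k + 1)) b) ⬝ᵥ (V *ᵥ (prodSegDL M 1 k *ᵥ y)) =
          wL ⬝ᵥ (prodSegDL (Function.update M (1 + k) V) 1 (L - 1) *ᵥ y) := by
      rw [hb, prodSegDL_update, ← dotProduct_mulVec, mulVec_mulVec, mulVec_mulVec,
        Matrix.mul_assoc]
    have key := dotProduct_mulVec_self_of_fderiv_eq_zero hℓ β lam
      ((∑ i, ∑ j, W0 i j ^ 2) +
        (∑ l ∈ (Finset.Icc 1 (L - 1)).erase (1 + k), ∑ i, ∑ j, M l i j ^ 2) + ∑ i, wL i ^ 2)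
      (M (1 + k)) (wL ᵥ* prodSegDL M (1 + (k + 1)) b)
      (fun s => prodSegDL M 1 k *ᵥ (W0 *ᵥ x s)) g
      (fun s => by rw [hout, Function.update_eq_self])
      (by
        rw [← hcritmid (1 + k) (by lia) (by lia)]
        congr 1
        funext V
        have hmem : 1 + k ∈ Finset.Icc 1 (L - 1) := Finset.mem_Icc.2 ⟨by lia, by lia⟩
        have hrest : ∑ l ∈ (Finset.Icc 1 (L - 1)).erase (1 + k),
              ∑ i, ∑ j, Function.update M (1 + k) V l i j ^ 2 =
            ∑ l ∈ (Finset.Icc 1 (L - 1)).erase (1 + k), ∑ i, ∑ j, M l i j ^ 2 :=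
          Finset.sum_congr rfl fun l hl => by
            rw [Function.update_of_ne (Finset.ne_of_mem_erase hl)]
        simp only [deepLinearLoss, hout]
        rw [← Finset.add_sum_erase _ _ hmem, hrest, Function.update_self]
        ring) (h k) (hsum k)
    rw [hout, Function.update_eq_self, hstep] at key
    exact key
  have houtput : β * (h (L - 1) ⬝ᵥ h (L - 1)) + lam * F = 0 := by
    let Λ (s : Fin S) : (Fin n → ℝ) →ₗ[ℝ] ℝ :=
      β • (dotProductBilin ℝ ℝ).flip (prodSegDL M 1 (L - 1) *ᵥ (W0 *ᵥ x s))
    have hcritL' := sum_deriv_mul_add_eq_zero_of_fderiv_eq_zero hℓ Λ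
      (fun i => LinearMap.proj i) lam
      ((∑ i, ∑ j, W0 i j ^ 2) + ∑ l ∈ Finset.Icc 1 (L - 1), ∑ i, ∑ j, M l i j ^ 2) wL hcritL
      (h (L - 1))
    have hΛ (s : Fin S) : deriv (ℓ s) (Λ s wL) * Λ s (h (L - 1)) =
        β * (h (L - 1) ⬝ᵥ (g s • (prodSegDL M 1 (L - 1) *ᵥ (W0 *ᵥ x s)))) := by
      change g s * (β * (h (L - 1) ⬝ᵥ (prodSegDL M 1 (L - 1) *ᵥ (W0 *ᵥ x s)))) = _
      rw [dotProduct_smul, smul_eq_mul]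
      ring
    rwa [Finset.sum_congr rfl fun s _ => hΛ s, ← Finset.mul_sum, ← dotProduct_sum,
      ← hsum] at hcritL'
  have hpow (k : ℕ) (hk : k ≤ L - 1) :
      lam ^ (k + 1) * (h k ⬝ᵥ h k) = (-(β * F)) ^ (k + 1) * (q ⬝ᵥ q) := by
    induction k with
    | zero => linear_combination hinput
    | succ k ih =>
      linear_combination lam ^ (k + 1) * hhidden k hk + (-(β * F)) * ih (by lia)
  have hβF : β * F ≠ 0 := by
    rintro h0
    exact hnontriv (by rw [hftil, hgf, h0, mul_zero])
  rw [hqq, hgf]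
  obtain ⟨N, rfl⟩ := Nat.exists_eq_add_of_le' hL
  simp only [Nat.add_sub_cancel] at *
  have hN := hpow N le_rfl
  rw [div_eq_iff (pow_ne_zero 2 hβ.ne')]
  refine mul_left_cancel₀ hβF ?_
  linear_combination β * lam ^ (N + 1) * houtput - β ^ 2 * hN
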